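/- Let f : ℕ → ℕ → ℕ be a symmetric addition-like function. Then there is a computable instance of RT^f_2 with no Σ⁰₂ solution: there exists a computable coloring c : ℕ → Bool such that for every computable relation R : ℕ → ℕ → ℕ → Bool, if the set H = {n | ∃ a, ∀ b, R n a b = true} is infinite, then there exist x, y, x', y' ∈ H with x ≠ y and x' ≠ y' such that c (f x y) ≠ c (f x' y'). -/

import Mathlib

/-- `f` is addition-like: it is computable; there is a computable `g` such that
`f x y > n` whenever `y > g x n`; and there is a bound `b` such that for all `x ≠ y`
there are at most `b` many `z ≠ x` with `f x z = f x y`. -/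
def AdditionLike (f : ℕ → ℕ → ℕ) : Prop :=
  Computable₂ f ∧
  (∃ g : ℕ → ℕ → ℕ, Computable₂ g ∧ ∀ x n y, y > g x n → f x y > n) ∧
  (∃ b : ℕ, ∀ x y, x ≠ y →
    ∀ S : Finset ℕ, (∀ z ∈ S, z ≠ x ∧ f x z = f x y) → S.card ≤ b)

lemma Computable.sum_range {α : Type*} [Primcodable α] {n : α → ℕ} {h : α → ℕ → ℕ}
    (hn : Computable n) (hh : Computable₂ h) :
    Computable fun a => ∑ i ∈ Finset.range (n a), h a i := by
  have hstep : Computable₂ fun (a : α) (q : ℕ × ℕ) => q.2 + h a q.1 :=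
    Primrec.nat_add.to_comp.comp (Computable.snd.comp Computable.snd)
      (hh.comp Computable.fst (Computable.fst.comp Computable.snd))
  refine (Computable.nat_rec hn (Computable.const 0) hstep).of_eq fun a => ?_
  generalize n a = k
  induction k with
  | zero => rfl
  | succ k ih => rw [Finset.sum_range_succ, ← ih]

namespace ComputablePred

variable {α β : Type*} [Primcodable α] [Primcodable β]

protected lemma comp {p : β → Prop} (hp : ComputablePred p) {k : α → β} (hk : Computable k) :
    ComputablePred fun a => p (k a) := by
  classical exact (hp.decide.comp hk).computablePred

protected lemma and {p q : α → Prop} (hp : ComputablePred p) (hq : ComputablePred q) :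
    ComputablePred fun a => p a ∧ q a := by
  classical
  exact Computable.computablePred
    ((Primrec.and.to_comp.comp hp.decide hq.decide).of_eq fun a => by simp)

protected lemma imp {p q : α → Prop} (hp : ComputablePred p) (hq : ComputablePred q) :
    ComputablePred fun a => p a → q a :=
  (hp.and hq.not).not.of_eq fun a => by simp

lemma eq_of_computable {γ : Type*} [Primcodable γ] {k l : α → γ} (hk : Computable k)
    (hl : Computable l) : ComputablePred fun a => k a = l a :=
  (PrimrecPred.computablePred (p := fun q : γ × γ => q.1 = q.2) Primrec.eq).comp (hk.pair hl)

lemma le_of_computable {k l : α → ℕ} (hk : Computable k) (hl : Computable l) :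
    ComputablePred fun a => k a ≤ l a :=
  (PrimrecPred.computablePred (p := fun q : ℕ × ℕ => q.1 ≤ q.2) Primrec.nat_le).comp (hk.pair hl)

lemma computable_card_filter {n : α → ℕ} {p : α → ℕ → Prop} [∀ a, DecidablePred (p a)]
    (hn : Computable n) (hp : ComputablePred fun q : α × ℕ => p q.1 q.2) :
    Computable fun a => ((Finset.range (n a)).filter (p a)).card := by
  have h : Computable₂ fun (a : α) (i : ℕ) => cond (decide (p a i)) 1 0 :=
    hp.decide.cond (Computable.const 1) (Computable.const 0)
  refine (Computable.sum_range hn h).of_eq fun a => ?_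
  rw [Finset.card_filter]
  exact Finset.sum_congr rfl fun i _ => by by_cases hi : p a i <;> simp [hi]

lemma exists_lt {n : α → ℕ} {p : α → ℕ → Prop} (hn : Computable n)
    (hp : ComputablePred fun q : α × ℕ => p q.1 q.2) :
    ComputablePred fun a => ∃ i < n a, p a i := by
  classical
  refine (eq_of_computable (computable_card_filter hn hp) (Computable.const 0)).not.of_eq
    fun a => ?_
  simp

lemma forall_lt {n : α → ℕ} {p : α → ℕ → Prop} (hn : Computable n)
    (hp : ComputablePred fun q : α × ℕ => p q.1 q.2) :
    ComputablePred fun a => ∀ i < n a, p a i :=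
  (exists_lt (p := fun a i => ¬ p a i) hn hp.not).not.of_eq fun a => by simp

end ComputablePred

lemma computable_testBit : Computable₂ Nat.testBit := by
  have h : Computable₂ fun (m n : ℕ) => m / 2 ^ n :=
    (Computable.nat_rec Computable.snd Computable.fst
      (Primrec.nat_div.to_comp.comp (Computable.snd.comp Computable.snd)
        (Computable.const 2)).to₂).of_eq fun q => by
      obtain ⟨m, n⟩ := q
      induction n with
      | zero => simp
      | succ n ih =>
        simp only at ih ⊢
        rw [ih, Nat.div_div_eq_div_mul, pow_succ]
  refine (Computable.nat_bodd.comp h).of_eq fun q => ?_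
  change (q.1 / 2 ^ q.2).bodd = _
  rw [Nat.testBit, ← Nat.shiftRight_eq_div_pow, Nat.one_and_eq_mod_two, Nat.bodd_eq_one_and_ne_zero,
    Nat.one_and_eq_mod_two]

/-- A strictly increasing computable sequence `p` starting at `0`, with block index `B`, such that
`f x s` lies within one block of `s` whenever `x` is below the block index of `s`. -/
lemma exists_blocks {f g : ℕ → ℕ → ℕ} (hf : Computable₂ f) (hg : Computable₂ g)
    (hfg : ∀ x n y, y > g x n → f x y > n) :
    ∃ p B : ℕ → ℕ, Computable p ∧ Computable B ∧ (∀ s k, B s < k ↔ s < p k) ∧ (∀ s, B s ≤ s) ∧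
      ∀ x s, x < B s → B s ≤ B (f x s) + 1 ∧ B (f x s) ≤ B s + 1 := by
  let H : ℕ → ℕ := fun n => n + 1 + ∑ x ∈ Finset.range (n + 1),
    (g x n + ∑ y ∈ Finset.range (n + 1), f x y)
  have hHc : Computable H := by
    have hinner : Computable₂ fun n x : ℕ => ∑ y ∈ Finset.range (n + 1), f x y :=
      Computable.sum_range (h := fun (q : ℕ × ℕ) y => f q.2 y)
        (Computable.succ.comp Computable.fst)
        (hf.comp (Computable.snd.comp Computable.fst) Computable.snd)
    exact Primrec.nat_add.to_comp.comp Computable.succ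
      (Computable.sum_range Computable.succ
        (Primrec.nat_add.to_comp.comp (hg.comp Computable.snd Computable.fst) hinner).to₂)
  have hHlt : ∀ n, n < H n := fun n => by simp only [H]; lia
  have hHg : ∀ x n, x ≤ n → g x n < H n := fun x n hx => by
    have := Finset.single_le_sum
      (f := fun x => g x n + ∑ y ∈ Finset.range (n + 1), f x y)
      (fun i _ => Nat.zero_le _) (Finset.mem_range.2 (Nat.lt_succ_of_le hx))
    simp only [H]; lia
  have hHf : ∀ x y n, x ≤ n → y ≤ n → f x y < H n := fun x y n hx hy => by
    have h1 := Finset.single_le_sum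
      (f := fun x => g x n + ∑ y ∈ Finset.range (n + 1), f x y)
      (fun i _ => Nat.zero_le _) (Finset.mem_range.2 (Nat.lt_succ_of_le hx))
    have h2 := Finset.single_le_sum (f := fun y => f x y)
      (fun i _ => Nat.zero_le _) (Finset.mem_range.2 (Nat.lt_succ_of_le hy))
    simp only [H]; lia
  let p : ℕ → ℕ := fun k => Nat.rec 0 (fun _ r => H r) k
  have hpc : Computable p :=
    Computable.nat_rec Computable.id (Computable.const 0)
      (hHc.comp (Computable.snd.comp Computable.snd)).to₂
  have hp0 : p 0 = 0 := rfl
  have hps : ∀ k, p (k + 1) = H (p k) := fun k => rfl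
  have hmono : StrictMono p := strictMono_nat_of_lt_succ fun k => by rw [hps]; exact hHlt _
  have hex : ∀ s, ∃ k, s < p (k + 1) := fun s => ⟨s, hmono.le_apply (x := s + 1)⟩
  let B : ℕ → ℕ := fun s => Nat.find (hex s)
  have hBc : Computable B := Computable.find
    ((ComputablePred.le_of_computable (Computable.succ.comp Computable.fst)
      (hpc.comp (Computable.succ.comp Computable.snd))).of_eq fun q => Iff.rfl) hex
  have hB : ∀ s k, B s < k ↔ s < p k := by
    intro s k
    cases k with
    | zero => simp [hp0]
    | succ k =>
      rw [Nat.lt_succ_iff, Nat.find_le_iff]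
      exact ⟨fun ⟨m, hm, h⟩ => h.trans_le (hmono.monotone (Nat.succ_le_succ hm)),
        fun h => ⟨k, le_rfl, h⟩⟩
  have hBle : ∀ s, B s ≤ s := fun s =>
    Nat.lt_succ_iff.1 ((hB s (s + 1)).2 (hmono.le_apply (x := s + 1)))
  refine ⟨p, B, hpc, hBc, hB, hBle, fun x s hx => ⟨?_, ?_⟩⟩
  · obtain ⟨t, ht⟩ : ∃ t, B s = t + 1 := ⟨B s - 1, by lia⟩
    have hs : H (p t) ≤ s := by
      rw [← hps]
      exact not_lt.1 fun h => absurd ((hB s (t + 1)).2 h) (by lia)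
    have hxt : x ≤ p t := (show x ≤ t by lia).trans hmono.le_apply
    have hlt : p t < f x s := hfg x (p t) s ((hHg x (p t) hxt).trans_le hs)
    have := (hB (f x s) t).not.2 (by lia)
    lia
  · have hs : s < p (B s + 1) := (hB s _).1 (Nat.lt_succ_self _)
    have hxs : x ≤ p (B s + 1) := by have := hBle s; lia
    have := (hB (f x s) (B s + 1 + 1)).2 (hHf x s _ hxs hs.le)
    lia

lemma weight_le (K e : ℕ) :
    ((3 * (3 * K * (11 * (e + K + 5))) * K : ℕ) : ℝ) *
      (2 * (2 / 3) ^ (11 * (e + K + 5) - 1)) ≤ 1 / 4 * (1 / 2) ^ e := by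
  obtain ⟨j, hj⟩ : ∃ j, j = e + K + 5 := ⟨_, rfl⟩
  rw [← hj]
  have hpow : (2 / 3 : ℝ) ^ (11 * j - 1) = 3 / 2 * ((2 / 3) ^ 11) ^ j := by
    rw [← pow_mul]
    obtain ⟨i, hi⟩ : ∃ i, 11 * j = i + 1 := ⟨11 * j - 1, by lia⟩
    rw [hi, Nat.add_sub_cancel, pow_succ]
    ring
  have hj2 : (j : ℝ) ≤ 2 ^ j := by exact_mod_cast Nat.lt_two_pow_self.le
  have hK : (K : ℝ) ≤ 2 ^ j :=
    le_trans (by exact_mod_cast (by lia : K ≤ j)) hj2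
  have hq : ((2 / 3 : ℝ) ^ 11) ^ j ≤ (1 / 64) ^ j := by
    gcongr; norm_num
  have hprod : (2 : ℝ) ^ j * 2 ^ j * 2 ^ j * (1 / 64) ^ j = (1 / 2) ^ j * (1 / 4) ^ j := by
    rw [← mul_pow, ← mul_pow, ← mul_pow, ← mul_pow]; norm_num
  have hej : (1 / 2 : ℝ) ^ j ≤ (1 / 2) ^ e * (1 / 2) ^ 5 := by
    rw [← pow_add]
    exact pow_le_pow_of_le_one (by norm_num) (by norm_num) (by lia)
  have h4 : (1 / 4 : ℝ) ^ j ≤ (1 / 4) ^ 5 :=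
    pow_le_pow_of_le_one (by norm_num) (by norm_num) (by lia)
  rw [hpow]
  push_cast
  calc 3 * (3 * (K : ℝ) * (11 * j)) * K * (2 * (3 / 2 * ((2 / 3) ^ 11) ^ j))
      = 297 * (K * K * j * ((2 / 3) ^ 11) ^ j) := by ring
    _ ≤ 297 * (2 ^ j * 2 ^ j * 2 ^ j * (1 / 64) ^ j) := by gcongr
    _ = 297 * ((1 / 2) ^ j * (1 / 4) ^ j) := by rw [hprod]
    _ ≤ 297 * ((1 / 2) ^ e * (1 / 2) ^ 5 * (1 / 4) ^ 5) := by gcongr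
    _ ≤ 1 / 4 * (1 / 2) ^ e := by
      have : (0 : ℝ) ≤ (1 / 2) ^ e := by positivity
      nlinarith

lemma sum_geometric_le (N : ℕ) : ∑ e ∈ Finset.range N, 1 / 4 * (1 / 2 : ℝ) ^ e ≤ 1 / 2 := by
  have h : ∑ e ∈ Finset.range N, 1 / 4 * (1 / 2 : ℝ) ^ e = 1 / 2 - 1 / 2 * (1 / 2) ^ N := by
    rw [← Finset.mul_sum, geom_sum_eq (by norm_num)]
    ring
  rw [h]
  have : (0 : ℝ) ≤ (1 / 2) ^ N := by positivity
  linarith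

/-- The sets `P ⊆ U` splitting every edge `A i`, `i ∈ I`, that is contained in `U`. -/
def properSplits {ι α : Type*} [DecidableEq α] (I : Finset ι) (A : ι → Finset α) (U : Finset α) :
    Finset (Finset α) :=
  U.powerset.filter fun P => ∀ i ∈ I, A i ⊆ U → ¬ A i ⊆ P ∧ ¬ Disjoint (A i) P

lemma mem_properSplits {ι α : Type*} [DecidableEq α] {I : Finset ι} {A : ι → Finset α}
    {U P : Finset α} : P ∈ properSplits I A U ↔
      P ⊆ U ∧ ∀ i ∈ I, A i ⊆ U → ¬ A i ⊆ P ∧ ¬ Disjoint (A i) P := by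
  simp [properSplits]

lemma two_mul_card_properSplits_le {ι α : Type*} [DecidableEq α] (I : Finset ι)
    (A : ι → Finset α) {U : Finset α} {v : α} (hv : v ∉ U) :
    2 * (properSplits I A U).card ≤ (properSplits I A (insert v U)).card +
      ∑ i ∈ I with v ∈ A i ∧ A i ⊆ insert v U, 2 * (properSplits I A (U \ A i)).card := by
  have hsub : ∀ P ∈ properSplits I A U, v ∉ P := fun P hP h =>
    hv ((mem_properSplits.1 hP).1 h)
  have hinj : ((properSplits I A U).image (insert v)).card = (properSplits I A U).card := by
    refine Finset.card_image_of_injOn fun P hP Q hQ h => ?_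
    have := congrArg (fun S => S.erase v) h
    simpa [Finset.erase_insert (hsub P hP), Finset.erase_insert (hsub Q hQ)] using this
  have hdisj : Disjoint (properSplits I A U) ((properSplits I A U).image (insert v)) := by
    rw [Finset.disjoint_left]
    intro P hP hP'
    obtain ⟨Q, -, rfl⟩ := Finset.mem_image.1 hP'
    exact hsub _ hP (Finset.mem_insert_self v Q)
  have hcard : 2 * (properSplits I A U).card =
      (properSplits I A U ∪ (properSplits I A U).image (insert v)).card := by
    rw [Finset.card_union_of_disjoint hdisj, hinj, two_mul]
  rw [hcard]
  let bad : ι → Finset (Finset α) := fun i =>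
    properSplits I A (U \ A i) ∪ (properSplits I A (U \ A i)).image (· ∪ A i)
  have hcover : properSplits I A U ∪ (properSplits I A U).image (insert v) ⊆
      properSplits I A (insert v U) ∪
        (I.filter fun i => v ∈ A i ∧ A i ⊆ insert v U).biUnion bad := by
    intro P hP
    have hP' : P.erase v ∈ properSplits I A U ∧ P ⊆ insert v U := by
      rcases Finset.mem_union.1 hP with h | h
      · rw [Finset.erase_eq_of_notMem (hsub P h)]
        exact ⟨h, (mem_properSplits.1 h).1.trans (Finset.subset_insert _ _)⟩
      · obtain ⟨Q, hQ, rfl⟩ := Finset.mem_image.1 h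
        rw [Finset.erase_insert (hsub Q hQ)]
        exact ⟨hQ, Finset.insert_subset_insert _ (mem_properSplits.1 hQ).1⟩
    obtain ⟨hPe, hPU⟩ := hP'
    rw [mem_properSplits] at hPe
    by_cases hgood : P ∈ properSplits I A (insert v U)
    · exact Finset.mem_union_left _ hgood
    refine Finset.mem_union_right _ ?_
    rw [mem_properSplits] at hgood
    push Not at hgood
    obtain ⟨i, hi, hiU, hbad⟩ := hgood hPU
    have hvi : v ∈ A i := by
      by_contra hvi
      have hiU' : A i ⊆ U := (Finset.subset_insert_iff_of_notMem hvi).1 hiU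
      obtain ⟨h1, h2⟩ := hPe.2 i hi hiU'
      have h3 : ¬ A i ⊆ P := fun h => h1 (Finset.subset_erase.2 ⟨h, hvi⟩)
      exact h2 ((hbad h3).mono_right (Finset.erase_subset _ _))
    have hQ : P \ A i ∈ properSplits I A (U \ A i) := by
      rw [mem_properSplits]
      refine ⟨?_, fun j hj hjU => ?_⟩
      · intro x hx
        simp only [Finset.mem_sdiff] at hx ⊢
        refine ⟨(Finset.mem_insert.1 (hPU hx.1)).resolve_left ?_, hx.2⟩
        rintro rfl
        exact hx.2 hvi
      · obtain ⟨h1, h2⟩ := hPe.2 j hj (hjU.trans Finset.sdiff_subset)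
        refine ⟨fun h => h1 fun x hx => ?_, fun h => h2 ?_⟩
        · have hx' := Finset.mem_sdiff.1 (h hx)
          refine Finset.mem_erase.2 ⟨?_, hx'.1⟩
          rintro rfl
          exact hx'.2 hvi
        · rw [Finset.disjoint_left] at h ⊢
          intro x hx hxP
          exact h hx (Finset.mem_sdiff.2
            ⟨Finset.mem_of_mem_erase hxP, (Finset.mem_sdiff.1 (hjU hx)).2⟩)
    refine Finset.mem_biUnion.2 ⟨i, Finset.mem_filter.2 ⟨hi, hvi, hiU⟩, ?_⟩
    by_cases hiP : A i ⊆ P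
    · exact Finset.mem_union_right _ (Finset.mem_image.2
        ⟨_, hQ, Finset.sdiff_union_of_subset hiP⟩)
    · refine Finset.mem_union_left _ ?_
      rwa [Finset.sdiff_eq_self_of_disjoint (hbad hiP).symm] at hQ
  refine (Finset.card_le_card hcover).trans ((Finset.card_union_le _ _).trans ?_)
  refine Nat.add_le_add_left (Finset.card_biUnion_le.trans (Finset.sum_le_sum fun i _ => ?_)) _
  refine (Finset.card_union_le _ _).trans ?_
  have := Finset.card_image_le (s := properSplits I A (U \ A i)) (f := (· ∪ A i))
  lia

/-- Rosenfeld's counting form of the local lemma for two-colorings. -/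
lemma card_properSplits_mul_pow_le {ι α : Type*} [DecidableEq α] (I : Finset ι)
    (A : ι → Finset α)
    (hw : ∀ v, ∑ i ∈ I with v ∈ A i, 2 * (2 / 3 : ℝ) ^ ((A i).card - 1) ≤ 1 / 2)
    {W U : Finset α} (hWU : W ⊆ U) :
    ((properSplits I A W).card : ℝ) * (3 / 2) ^ (U \ W).card ≤ (properSplits I A U).card := by
  induction U using Finset.strongInduction generalizing W with
  | H U ih =>
  rcases hWU.eq_or_ssubset with rfl | hss
  · simp
  obtain ⟨v, hvU, hvW⟩ := Finset.exists_of_ssubset hss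
  have hlt : U.erase v ⊂ U := Finset.erase_ssubset hvU
  have hins : insert v (U.erase v) = U := Finset.insert_erase hvU
  have hstep := two_mul_card_properSplits_le I A (Finset.notMem_erase v U)
  rw [hins] at hstep
  have hstep' : (2 : ℝ) * (properSplits I A (U.erase v)).card ≤ (properSplits I A U).card +
      ∑ i ∈ I with v ∈ A i ∧ A i ⊆ U, 2 * ((properSplits I A (U.erase v \ A i)).card : ℝ) := by
    exact_mod_cast hstep
  have hsum : ∑ i ∈ I with v ∈ A i ∧ A i ⊆ U,
      2 * ((properSplits I A (U.erase v \ A i)).card : ℝ) ≤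
      1 / 2 * (properSplits I A (U.erase v)).card := by
    calc _ ≤ ∑ i ∈ I with v ∈ A i ∧ A i ⊆ U,
          2 * (2 / 3 : ℝ) ^ ((A i).card - 1) * (properSplits I A (U.erase v)).card := by
          refine Finset.sum_le_sum fun i hi => ?_
          obtain ⟨-, hvi, hiU⟩ := Finset.mem_filter.1 hi
          have h := ih _ hlt (W := U.erase v \ A i) Finset.sdiff_subset
          have hc : (U.erase v \ (U.erase v \ A i)).card = (A i).card - 1 := by
            rw [sdiff_sdiff_right_self, ← Finset.card_erase_of_mem hvi]
            congr 1
            ext x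
            simp only [Finset.inf_eq_inter, Finset.mem_inter, Finset.mem_erase]
            exact ⟨fun h => ⟨h.1.1, h.2⟩, fun h => ⟨⟨h.1, hiU h.2⟩, h.2⟩⟩
          rw [hc] at h
          have hp : (2 / 3 : ℝ) ^ ((A i).card - 1) * (3 / 2) ^ ((A i).card - 1) = 1 := by
            rw [← mul_pow]; norm_num
          calc 2 * ((properSplits I A (U.erase v \ A i)).card : ℝ)
              = 2 * ((2 / 3 : ℝ) ^ ((A i).card - 1) *
                  ((properSplits I A (U.erase v \ A i)).card * (3 / 2) ^ ((A i).card - 1))) := by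
                linear_combination
                  (-2 * ((properSplits I A (U.erase v \ A i)).card : ℝ)) * hp
            _ ≤ 2 * ((2 / 3 : ℝ) ^ ((A i).card - 1) * (properSplits I A (U.erase v)).card) := by
                gcongr
            _ = _ := by ring
      _ ≤ ∑ i ∈ I with v ∈ A i,
          2 * (2 / 3 : ℝ) ^ ((A i).card - 1) * (properSplits I A (U.erase v)).card := by
          refine Finset.sum_le_sum_of_subset_of_nonneg ?_ fun _ _ _ => by positivity
          intro i hi
          simp only [Finset.mem_filter] at hi ⊢
          exact ⟨hi.1, hi.2.1⟩
      _ ≤ _ := by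
          rw [← Finset.sum_mul]
          exact mul_le_mul_of_nonneg_right (hw v) (Nat.cast_nonneg _)
  have hW := ih _ hlt (W := W) (Finset.subset_erase.2 ⟨hWU, hvW⟩)
  have hcW : (U \ W).card = (U.erase v \ W).card + 1 := by
    rw [Finset.erase_sdiff_comm,
      Finset.card_erase_add_one (Finset.mem_sdiff.2 ⟨hvU, hvW⟩)]
  rw [hcW, pow_succ]
  linarith

lemma exists_two_coloring {ι α : Type*} [DecidableEq α] (I : Finset ι) (A : ι → Finset α)
    (hne : ∀ i ∈ I, (A i).Nonempty)
    (hw : ∀ v, ∑ i ∈ I with v ∈ A i, 2 * (2 / 3 : ℝ) ^ ((A i).card - 1) ≤ 1 / 2) :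
    ∃ χ : α → Bool, ∀ i ∈ I, ∃ x ∈ A i, ∃ y ∈ A i, χ x ≠ χ y := by
  have h := card_properSplits_mul_pow_le I A hw (Finset.empty_subset (I.biUnion A))
  have h0 : (properSplits I A ∅).card = 1 := by
    rw [Finset.card_eq_one]
    refine ⟨∅, Finset.ext fun P => ?_⟩
    simp only [mem_properSplits, Finset.subset_empty, Finset.mem_singleton, and_iff_left_iff_imp]
    intro _ i hi hiU
    exact absurd hiU (hne i hi).ne_empty
  have hpos : (0 : ℝ) < (properSplits I A (I.biUnion A)).card := by
    refine lt_of_lt_of_le ?_ h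
    rw [h0]; positivity
  obtain ⟨P, hP⟩ := Finset.card_pos.1 (Nat.cast_pos.1 hpos)
  refine ⟨fun x => decide (x ∈ P), fun i hi => ?_⟩
  obtain ⟨h1, h2⟩ := (mem_properSplits.1 hP).2 i hi (Finset.subset_biUnion_of_mem A hi)
  obtain ⟨x, hx, hxP⟩ := Finset.not_subset.1 h1
  obtain ⟨y, hy, hyP⟩ := Finset.not_disjoint_iff.1 h2
  exact ⟨x, hx, y, hy, by simp [hxP, hyP]⟩

/-- The part in block `k` of the set of all `f x s` with `x` in the finite set attached to `e` and
the block of `s`. -/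
def blockSlice (f : ℕ → ℕ → ℕ) (G : ℕ → ℕ → Finset ℕ) (B : ℕ → ℕ) (e s k : ℕ) : Finset ℕ :=
  ((G e (B s)).image fun x => f x s).filter fun v => B v = k

lemma mem_blockSlice {f : ℕ → ℕ → ℕ} {G : ℕ → ℕ → Finset ℕ} {B : ℕ → ℕ} {e s k v : ℕ} :
    v ∈ blockSlice f G B e s k ↔ (∃ x ∈ G e (B s), f x s = v) ∧ B v = k := by
  simp [blockSlice]

lemma card_blockSlice_le {f : ℕ → ℕ → ℕ} {G : ℕ → ℕ → Finset ℕ} {B : ℕ → ℕ} (e s k : ℕ) :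
    (blockSlice f G B e s k).card ≤ (G e (B s)).card :=
  (Finset.card_filter_le _ _).trans Finset.card_image_le

lemma card_filter_mem_blockSlice_le {f : ℕ → ℕ → ℕ} {G : ℕ → ℕ → Finset ℕ} {B m : ℕ → ℕ} {K : ℕ}
    (hfib : ∀ x y, x ≠ y → ∀ S : Finset ℕ, (∀ z ∈ S, z ≠ x ∧ f x z = f x y) → S.card ≤ K)
    (hBle : ∀ s, B s ≤ s)
    (hBf : ∀ x s, x < B s → B s ≤ B (f x s) + 1 ∧ B (f x s) ≤ B s + 1)
    (hGlt : ∀ e u, ∀ x ∈ G e u, x < u) (hGcard : ∀ e u, (G e u).card ≤ m e) (N e k v : ℕ) :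
    ((Finset.range N).filter fun s => v ∈ blockSlice f G B e s k).card ≤ 3 * m e * K := by
  have hsub : ((Finset.range N).filter fun s => v ∈ blockSlice f G B e s k) ⊆
      (G e (k - 1) ∪ G e k ∪ G e (k + 1)).biUnion fun x =>
        (Finset.range N).filter fun s => s ≠ x ∧ f x s = v := by
    intro s hs
    obtain ⟨hsN, hv⟩ := Finset.mem_filter.1 hs
    obtain ⟨⟨x, hx, hxv⟩, hk⟩ := mem_blockSlice.1 hv
    have hxB := hGlt _ _ _ hx
    have h := hBf x s hxB
    rw [hxv, hk] at h
    have hxs := hBle s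
    refine Finset.mem_biUnion.2 ⟨x, ?_, Finset.mem_filter.2 ⟨hsN, by lia, hxv⟩⟩
    simp only [Finset.mem_union]
    have h3 : B s = k - 1 ∨ B s = k ∨ B s = k + 1 := by lia
    rcases h3 with h3 | h3 | h3 <;> rw [h3] at hx <;> simp [hx]
  refine (Finset.card_le_card hsub).trans ((Finset.card_biUnion_le_card_mul _ _ K ?_).trans ?_)
  · intro x _
    rcases ((Finset.range N).filter fun s => s ≠ x ∧ f x s = v).eq_empty_or_nonempty
      with h | ⟨y, hy⟩
    · simp [h]
    · obtain ⟨-, hyx, hyv⟩ := Finset.mem_filter.1 hy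
      refine hfib x y hyx.symm _ fun z hz => ?_
      obtain ⟨-, hzx, hzv⟩ := Finset.mem_filter.1 hz
      exact ⟨hzx, hzv.trans hyv.symm⟩
  · refine Nat.mul_le_mul_right _ ?_
    have h1 := Finset.card_union_le (G e (k - 1) ∪ G e k) (G e (k + 1))
    have h2 := Finset.card_union_le (G e (k - 1)) (G e k)
    have := hGcard e (k - 1)
    have := hGcard e k
    have := hGcard e (k + 1)
    lia

lemma exists_block_coloring {f : ℕ → ℕ → ℕ} {G : ℕ → ℕ → Finset ℕ} {B : ℕ → ℕ} {K : ℕ}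
    (hfib : ∀ x y, x ≠ y → ∀ S : Finset ℕ, (∀ z ∈ S, z ≠ x ∧ f x z = f x y) → S.card ≤ K)
    (hBle : ∀ s, B s ≤ s)
    (hBf : ∀ x s, x < B s → B s ≤ B (f x s) + 1 ∧ B (f x s) ≤ B s + 1)
    (hGlt : ∀ e u, ∀ x ∈ G e u, x < u)
    (hGcard : ∀ e u, (G e u).card ≤ 3 * K * (11 * (e + K + 5))) (N k : ℕ) :
    ∃ χ : ℕ → Bool, ∀ s < N, ∀ e < N, 11 * (e + K + 5) ≤ (blockSlice f G B e s k).card →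
      ∃ v ∈ blockSlice f G B e s k, ∃ v' ∈ blockSlice f G B e s k, χ v ≠ χ v' := by
  let I : Finset (ℕ × ℕ) := (Finset.range N ×ˢ Finset.range N).filter fun i =>
    11 * (i.1 + K + 5) ≤ (blockSlice f G B i.1 i.2 k).card
  suffices h : ∃ χ : ℕ → Bool, ∀ i ∈ I, ∃ v ∈ blockSlice f G B i.1 i.2 k,
      ∃ v' ∈ blockSlice f G B i.1 i.2 k, χ v ≠ χ v' by
    obtain ⟨χ, hχ⟩ := h
    refine ⟨χ, fun s hs e he h => hχ (e, s) ?_⟩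
    simp only [I, Finset.mem_filter, Finset.mem_product, Finset.mem_range]
    exact ⟨⟨he, hs⟩, h⟩
  refine exists_two_coloring I (fun i => blockSlice f G B i.1 i.2 k) ?_ ?_
  · intro i hi
    have := (Finset.mem_filter.1 hi).2
    exact Finset.card_pos.1 (by lia)
  · intro v
    calc ∑ i ∈ I with v ∈ blockSlice f G B i.1 i.2 k,
          2 * (2 / 3 : ℝ) ^ ((blockSlice f G B i.1 i.2 k).card - 1)
        ≤ ∑ i ∈ I with v ∈ blockSlice f G B i.1 i.2 k,
          2 * (2 / 3 : ℝ) ^ (11 * (i.1 + K + 5) - 1) := by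
          refine Finset.sum_le_sum fun i hi => ?_
          have := (Finset.mem_filter.1 (Finset.mem_filter.1 hi).1).2
          exact mul_le_mul_of_nonneg_left
            (pow_le_pow_of_le_one (by norm_num) (by norm_num) (by lia)) zero_le_two
      _ ≤ ∑ i ∈ (Finset.range N ×ˢ Finset.range N) with v ∈ blockSlice f G B i.1 i.2 k,
          2 * (2 / 3 : ℝ) ^ (11 * (i.1 + K + 5) - 1) := by
          refine Finset.sum_le_sum_of_subset_of_nonneg ?_ fun _ _ _ => by positivity
          exact Finset.filter_subset_filter _ (Finset.filter_subset _ _)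
      _ = ∑ e ∈ Finset.range N,
          (((Finset.range N).filter fun s => v ∈ blockSlice f G B e s k).card : ℝ) *
            (2 * (2 / 3 : ℝ) ^ (11 * (e + K + 5) - 1)) := by
          rw [Finset.sum_filter, Finset.sum_product]
          refine Finset.sum_congr rfl fun e _ => ?_
          rw [← Finset.sum_filter]
          simp only [Finset.sum_const, nsmul_eq_mul]
      _ ≤ ∑ e ∈ Finset.range N, 1 / 4 * (1 / 2 : ℝ) ^ e := by
          refine Finset.sum_le_sum fun e _ => le_trans ?_ (weight_le K e)
          refine mul_le_mul_of_nonneg_right (Nat.cast_le.2 ?_) (by positivity)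
          exact card_filter_mem_blockSlice_le
            (m := fun e => 3 * K * (11 * (e + K + 5))) hfib hBle hBf hGlt hGcard N e k v
      _ ≤ 1 / 2 := sum_geometric_le N

lemma exists_large_blockSlice {f : ℕ → ℕ → ℕ} {G : ℕ → ℕ → Finset ℕ} {B : ℕ → ℕ} {K M : ℕ}
    (hsym : ∀ x y, f x y = f y x)
    (hfib : ∀ x y, x ≠ y → ∀ S : Finset ℕ, (∀ z ∈ S, z ≠ x ∧ f x z = f x y) → S.card ≤ K)
    (hK : 0 < K) (hBle : ∀ s, B s ≤ s)
    (hBf : ∀ x s, x < B s → B s ≤ B (f x s) + 1 ∧ B (f x s) ≤ B s + 1)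
    (hGlt : ∀ e u, ∀ x ∈ G e u, x < u) {e s : ℕ} (hcard : 3 * K * M ≤ (G e (B s)).card) :
    ∃ k, B s ≤ k + 1 ∧ M ≤ (blockSlice f G B e s k).card := by
  have himg : (G e (B s)).card ≤ K * ((G e (B s)).image fun x => f x s).card := by
    refine Finset.card_le_mul_card_image _ _ fun v hv => ?_
    obtain ⟨y, hy, rfl⟩ := Finset.mem_image.1 hv
    have hne : ∀ z ∈ G e (B s), z ≠ s := fun z hz =>
      ((hGlt _ _ z hz).trans_le (hBle s)).ne
    refine hfib s y (hne y hy).symm _ fun z hz => ?_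
    obtain ⟨hz, hzv⟩ := Finset.mem_filter.1 hz
    exact ⟨hne z hz, by rw [hsym s z, hsym s y, hzv]⟩
  have himg' : 3 * M ≤ ((G e (B s)).image fun x => f x s).card := by
    refine le_of_mul_le_mul_left (a := K) ?_ hK
    calc K * (3 * M) = 3 * K * M := by ring
      _ ≤ _ := hcard.trans himg
  have hcover : ((G e (B s)).image fun x => f x s) ⊆ blockSlice f G B e s (B s - 1) ∪
      blockSlice f G B e s (B s) ∪ blockSlice f G B e s (B s + 1) := by
    intro v hv
    obtain ⟨x, hx, rfl⟩ := Finset.mem_image.1 hv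
    have h := hBf x s (hGlt _ _ x hx)
    simp only [Finset.mem_union, mem_blockSlice]
    have h3 : B (f x s) = B s - 1 ∨ B (f x s) = B s ∨ B (f x s) = B s + 1 := by lia
    rcases h3 with h3 | h3 | h3
    · exact Or.inl (Or.inl ⟨⟨x, hx, rfl⟩, h3⟩)
    · exact Or.inl (Or.inr ⟨⟨x, hx, rfl⟩, h3⟩)
    · exact Or.inr ⟨⟨x, hx, rfl⟩, h3⟩
  have h1 := Finset.card_le_card hcover
  have h2 := Finset.card_union_le (blockSlice f G B e s (B s - 1) ∪ blockSlice f G B e s (B s))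
    (blockSlice f G B e s (B s + 1))
  have h3 := Finset.card_union_le (blockSlice f G B e s (B s - 1)) (blockSlice f G B e s (B s))
  by_contra! hcon
  have := hcon (B s - 1) (by lia)
  have := hcon (B s) (by lia)
  have := hcon (B s + 1) (by lia)
  lia

lemma computable_blockSlice {f : ℕ → ℕ → ℕ} {G : ℕ → ℕ → Finset ℕ} {B : ℕ → ℕ}
    (hf : Computable₂ f) (hB : Computable B) (hGlt : ∀ e u, ∀ x ∈ G e u, x < u)
    (hG : ComputablePred fun q : (ℕ × ℕ) × ℕ => q.2 ∈ G q.1.1 q.1.2) {α : Type*} [Primcodable α]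
    {e s k v : α → ℕ} (he : Computable e) (hs : Computable s) (hk : Computable k)
    (hv : Computable v) :
    ComputablePred fun a => v a ∈ blockSlice f G B (e a) (s a) (k a) := by
  have hex : ComputablePred fun a => ∃ x < B (s a), x ∈ G (e a) (B (s a)) ∧ f x (s a) = v a :=
    ComputablePred.exists_lt (p := fun a x => x ∈ G (e a) (B (s a)) ∧ f x (s a) = v a)
      (hB.comp hs) <| ComputablePred.and
        (hG.comp (((he.comp Computable.fst).pair (hB.comp (hs.comp Computable.fst))).pair
          Computable.snd))
        (ComputablePred.eq_of_computable (hf.comp Computable.snd (hs.comp Computable.fst))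
          (hv.comp Computable.fst))
  refine (hex.and (ComputablePred.eq_of_computable (hB.comp hv) hk)).of_eq fun a => ?_
  rw [mem_blockSlice]
  refine and_congr_left fun _ => ⟨fun ⟨x, _, h⟩ => ⟨x, h⟩, fun ⟨x, h⟩ => ⟨x, hGlt _ _ _ h.1, h⟩⟩

/-- A computable coloring that is nonconstant on all sets `{f x s | x ∈ G e (B s)}` for which
`G e (B s)` has full size. -/
lemma exists_computable_coloring {f : ℕ → ℕ → ℕ} {G : ℕ → ℕ → Finset ℕ} {p B : ℕ → ℕ} {K : ℕ}
    (hsym : ∀ x y, f x y = f y x) (hf : Computable₂ f)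
    (hfib : ∀ x y, x ≠ y → ∀ S : Finset ℕ, (∀ z ∈ S, z ≠ x ∧ f x z = f x y) → S.card ≤ K)
    (hK : 0 < K) (hpc : Computable p) (hBc : Computable B) (hB : ∀ s k, B s < k ↔ s < p k)
    (hBle : ∀ s, B s ≤ s)
    (hBf : ∀ x s, x < B s → B s ≤ B (f x s) + 1 ∧ B (f x s) ≤ B s + 1)
    (hGlt : ∀ e u, ∀ x ∈ G e u, x < u)
    (hGcard : ∀ e u, (G e u).card ≤ 3 * K * (11 * (e + K + 5)))
    (hG : ComputablePred fun q : (ℕ × ℕ) × ℕ => q.2 ∈ G q.1.1 q.1.2) :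
    ∃ c : ℕ → Bool, Computable c ∧
      ∀ e s, 3 * K * (11 * (e + K + 5)) ≤ (G e (B s)).card →
        ∃ x ∈ G e (B s), ∃ x' ∈ G e (B s), c (f x s) ≠ c (f x' s) := by
  classical
  have hlt : ∀ e s k, ∀ v ∈ blockSlice f G B e s k, v < p (k + 1) := fun e s k v hv =>
    (hB v (k + 1)).1 (by have := (mem_blockSlice.1 hv).2; lia)
  let Valid : ℕ → ℕ → Prop := fun k w => ∀ s < p (k + 2), ∀ e < p (k + 2),
    11 * (e + K + 5) ≤ (blockSlice f G B e s k).card →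
      ∃ v < p (k + 1), ∃ v' < p (k + 1), v ∈ blockSlice f G B e s k ∧
        v' ∈ blockSlice f G B e s k ∧ w.testBit v ≠ w.testBit v'
  have hex : ∀ k, ∃ w, Valid k w := by
    intro k
    obtain ⟨χ, hχ⟩ := exists_block_coloring hfib hBle hBf hGlt hGcard (p (k + 2)) k
    refine ⟨Nat.ofBits fun i : Fin (p (k + 1)) => χ i, fun s hs e he h => ?_⟩
    obtain ⟨v, hv, v', hv', hne⟩ := hχ s hs e he h
    refine ⟨v, hlt _ _ _ v hv, v', hlt _ _ _ v' hv', hv, hv', ?_⟩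
    rw [Nat.testBit_ofBits_lt _ _ (hlt _ _ _ v hv), Nat.testBit_ofBits_lt _ _ (hlt _ _ _ v' hv')]
    exact hne
  have hValid : ComputablePred fun q : ℕ × ℕ => Valid q.1 q.2 := by
    have hadd : ∀ i, Computable fun k => p (k + i) := fun i =>
      hpc.comp (Primrec.nat_add.to_comp.comp Computable.id (Computable.const i))
    have hcard : Computable fun q : ((ℕ × ℕ) × ℕ) × ℕ =>
        (blockSlice f G B q.2 q.1.2 q.1.1.1).card := by
      have hc := ComputablePred.computable_card_filter
        (n := fun q : ((ℕ × ℕ) × ℕ) × ℕ => p (q.1.1.1 + 1))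
        (p := fun q v => v ∈ blockSlice f G B q.2 q.1.2 q.1.1.1)
        ((hadd 1).comp (Computable.fst.comp (Computable.fst.comp Computable.fst)))
        (computable_blockSlice hf hBc hGlt hG (Computable.snd.comp Computable.fst)
          (Computable.snd.comp (Computable.fst.comp Computable.fst))
          (Computable.fst.comp (Computable.fst.comp (Computable.fst.comp Computable.fst)))
          Computable.snd)
      refine hc.of_eq fun q => congrArg Finset.card (Finset.ext fun v => ?_)
      simp only [Finset.mem_filter, Finset.mem_range, and_iff_right_iff_imp]
      exact hlt _ _ _ v
    have hbound : Computable fun e : ℕ => 11 * (e + K + 5) :=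
      (Primrec.nat_mul.comp (Primrec.const 11) (Primrec.nat_add.comp
        (Primrec.nat_add.comp Primrec.id (Primrec.const K)) (Primrec.const 5))).to_comp
    refine ComputablePred.forall_lt
      (p := fun (q : ℕ × ℕ) s => ∀ e < p (q.1 + 2),
        11 * (e + K + 5) ≤ (blockSlice f G B e s q.1).card →
        ∃ v < p (q.1 + 1), ∃ v' < p (q.1 + 1), v ∈ blockSlice f G B e s q.1 ∧
          v' ∈ blockSlice f G B e s q.1 ∧ q.2.testBit v ≠ q.2.testBit v')
      ((hadd 2).comp Computable.fst) ?_
    refine ComputablePred.forall_lt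
      (p := fun (q : (ℕ × ℕ) × ℕ) e =>
        11 * (e + K + 5) ≤ (blockSlice f G B e q.2 q.1.1).card →
        ∃ v < p (q.1.1 + 1), ∃ v' < p (q.1.1 + 1), v ∈ blockSlice f G B e q.2 q.1.1 ∧
          v' ∈ blockSlice f G B e q.2 q.1.1 ∧ q.1.2.testBit v ≠ q.1.2.testBit v')
      ((hadd 2).comp (Computable.fst.comp Computable.fst)) ?_
    refine (ComputablePred.le_of_computable (hbound.comp Computable.snd) hcard).imp ?_
    have hk : Computable fun q : ((ℕ × ℕ) × ℕ) × ℕ => q.1.1.1 :=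
      Computable.fst.comp (Computable.fst.comp Computable.fst)
    have hw : Computable fun q : ((ℕ × ℕ) × ℕ) × ℕ => q.1.1.2 :=
      Computable.snd.comp (Computable.fst.comp Computable.fst)
    have hs : Computable fun q : ((ℕ × ℕ) × ℕ) × ℕ => q.1.2 :=
      Computable.snd.comp Computable.fst
    refine ComputablePred.exists_lt
      (p := fun (q : ((ℕ × ℕ) × ℕ) × ℕ) v => ∃ v' < p (q.1.1.1 + 1),
        v ∈ blockSlice f G B q.2 q.1.2 q.1.1.1 ∧ v' ∈ blockSlice f G B q.2 q.1.2 q.1.1.1 ∧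
          q.1.1.2.testBit v ≠ q.1.1.2.testBit v')
      ((hadd 1).comp hk) ?_
    refine ComputablePred.exists_lt
      (p := fun (q : (((ℕ × ℕ) × ℕ) × ℕ) × ℕ) v' =>
        q.2 ∈ blockSlice f G B q.1.2 q.1.1.2 q.1.1.1.1 ∧
          v' ∈ blockSlice f G B q.1.2 q.1.1.2 q.1.1.1.1 ∧
          q.1.1.1.2.testBit q.2 ≠ q.1.1.1.2.testBit v')
      ((hadd 1).comp (hk.comp Computable.fst)) ?_
    have hproj : Computable fun q : ((((ℕ × ℕ) × ℕ) × ℕ) × ℕ) × ℕ => q.1.1 :=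
      Computable.fst.comp Computable.fst
    have hv : Computable fun q : ((((ℕ × ℕ) × ℕ) × ℕ) × ℕ) × ℕ => q.1.2 :=
      Computable.snd.comp Computable.fst
    have hmem := fun {v : ((((ℕ × ℕ) × ℕ) × ℕ) × ℕ) × ℕ → ℕ} (hv : Computable v) =>
      computable_blockSlice hf hBc hGlt hG (Computable.snd.comp hproj) (hs.comp hproj)
        (hk.comp hproj) hv
    exact (hmem hv).and ((hmem Computable.snd).and (ComputablePred.eq_of_computable
      (computable_testBit.comp (hw.comp hproj) hv)
      (computable_testBit.comp (hw.comp hproj) Computable.snd)).not)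
  refine ⟨fun v => (Nat.find (hex (B v))).testBit v,
    computable_testBit.comp ((Computable.find hValid hex).comp hBc) Computable.id,
    fun e s hcard => ?_⟩
  obtain ⟨k, hk, hM⟩ := exists_large_blockSlice hsym hfib hK hBle hBf hGlt hcard
  have hs : s < p (k + 2) := (hB _ _).1 (by lia)
  have he : e ≤ s := by
    have h1 := (hM.trans (card_blockSlice_le e s k)).trans
      (Finset.card_le_card (t := Finset.range (B s)) fun x hx =>
        Finset.mem_range.2 (hGlt _ _ x hx))
    rw [Finset.card_range] at h1
    have := hBle s
    lia
  obtain ⟨v, -, v', -, hv, hv', hne⟩ := Nat.find_spec (hex k) s hs e (he.trans_lt hs) hM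
  obtain ⟨⟨x, hx, rfl⟩, hxk⟩ := mem_blockSlice.1 hv
  obtain ⟨⟨x', hx', rfl⟩, hxk'⟩ := mem_blockSlice.1 hv'
  exact ⟨x, hx, x', hx', by simpa only [hxk, hxk'] using hne⟩

/-- No witness below `u` shows, within `u` steps, that the code `e` takes the value `0` at some
`Nat.pair q b`. -/
def IsUnrefuted (e u q : ℕ) : Prop :=
  ∀ b < u, Nat.Partrec.Code.evaln u (Denumerable.ofNat Nat.Partrec.Code e) (Nat.pair q b) ≠ some 0

lemma computable_isUnrefuted :
    ComputablePred fun q : (ℕ × ℕ) × ℕ => IsUnrefuted q.1.1 q.1.2 q.2 := by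
  have hu : Computable fun q : ((ℕ × ℕ) × ℕ) × ℕ => q.1.1.2 :=
    Computable.snd.comp (Computable.fst.comp Computable.fst)
  have he : Computable fun q : ((ℕ × ℕ) × ℕ) × ℕ => q.1.1.1 :=
    Computable.fst.comp (Computable.fst.comp Computable.fst)
  exact ComputablePred.forall_lt
    (p := fun (q : (ℕ × ℕ) × ℕ) b => Nat.Partrec.Code.evaln q.1.2
      (Denumerable.ofNat Nat.Partrec.Code q.1.1) (Nat.pair q.2 b) ≠ some 0)
    (Computable.snd.comp Computable.fst)
    (ComputablePred.eq_of_computable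
      (Nat.Partrec.Code.primrec_evaln.to_comp.comp
        ((hu.pair ((Computable.ofNat Nat.Partrec.Code).comp he)).pair
          (Primrec₂.natPair.to_comp.comp (Computable.snd.comp Computable.fst) Computable.snd)))
      (Computable.const (some 0))).not

open Classical in
/-- First components of the pairs with code below `r` that are unrefuted at stage `u`. -/
noncomputable def unrefutedBelow (e u r : ℕ) : Finset ℕ :=
  ((Finset.range r).filter (IsUnrefuted e u)).image fun q => q.unpair.1

lemma mem_unrefutedBelow {e u r x : ℕ} :
    x ∈ unrefutedBelow e u r ↔ ∃ q < r, IsUnrefuted e u q ∧ q.unpair.1 = x := by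
  simp [unrefutedBelow, and_assoc]

lemma lt_of_mem_unrefutedBelow {e u r x : ℕ} (h : x ∈ unrefutedBelow e u r) : x < r := by
  obtain ⟨q, hq, -, rfl⟩ := mem_unrefutedBelow.1 h
  exact (Nat.unpair_left_le q).trans_lt hq

lemma unrefutedBelow_mono (e u : ℕ) : Monotone (unrefutedBelow e u) := fun r r' hr x hx => by
  obtain ⟨q, hq, h⟩ := mem_unrefutedBelow.1 hx
  exact mem_unrefutedBelow.2 ⟨q, hq.trans_le hr, h⟩

open Classical in
/-- The stage-`u` approximation to the first `m` elements of the `e`-th `Σ⁰₂` set. -/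
noncomputable def sigmaTwoApprox (m e u : ℕ) : Finset ℕ :=
  unrefutedBelow e u (Nat.findGreatest (fun r => (unrefutedBelow e u r).card ≤ m) u)

lemma card_sigmaTwoApprox_le (m e u : ℕ) : (sigmaTwoApprox m e u).card ≤ m :=
  Nat.findGreatest_spec (P := fun r => (unrefutedBelow e u r).card ≤ m) (Nat.zero_le u)
    (by simp [unrefutedBelow])

lemma lt_of_mem_sigmaTwoApprox {m e u x : ℕ} (h : x ∈ sigmaTwoApprox m e u) : x < u :=
  (lt_of_mem_unrefutedBelow h).trans_le (Nat.findGreatest_le u)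

lemma mem_sigmaTwoApprox {m e u x : ℕ} : x ∈ sigmaTwoApprox m e u ↔
    ∃ r < u + 1, (unrefutedBelow e u r).card ≤ m ∧ x ∈ unrefutedBelow e u r := by
  refine ⟨fun h => ⟨_, Nat.lt_succ_of_le (Nat.findGreatest_le u), card_sigmaTwoApprox_le m e u, h⟩,
    fun ⟨r, hr, hm, hx⟩ => unrefutedBelow_mono e u
      (Nat.le_findGreatest (P := fun r => (unrefutedBelow e u r).card ≤ m)
        (Nat.lt_succ_iff.1 hr) hm) hx⟩

lemma computable_sigmaTwoApprox {m : ℕ → ℕ} (hm : Computable m) :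
    ComputablePred fun q : (ℕ × ℕ) × ℕ => q.2 ∈ sigmaTwoApprox (m q.1.1) q.1.1 q.1.2 := by
  have hmem : ∀ {α : Type} [Primcodable α] {k : α → ℕ × ℕ} {r x : α → ℕ}, Computable k →
      Computable r → Computable x →
      ComputablePred fun a => x a ∈ unrefutedBelow (k a).1 (k a).2 (r a) := by
    intro α _ k r x hk hr hx
    refine (ComputablePred.exists_lt
      (p := fun a q => IsUnrefuted (k a).1 (k a).2 q ∧ q.unpair.1 = x a) hr
      (ComputablePred.and
        (computable_isUnrefuted.comp ((hk.comp Computable.fst).pair Computable.snd))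
        (ComputablePred.eq_of_computable
          (Computable.fst.comp (Computable.unpair.comp Computable.snd))
          (hx.comp Computable.fst)))).of_eq fun a => mem_unrefutedBelow.symm
  have hcard : Computable fun q : ((ℕ × ℕ) × ℕ) × ℕ =>
      (unrefutedBelow q.1.1.1 q.1.1.2 q.2).card := by
    refine (ComputablePred.computable_card_filter
      (p := fun (q : ((ℕ × ℕ) × ℕ) × ℕ) x => x ∈ unrefutedBelow q.1.1.1 q.1.1.2 q.2)
      Computable.snd
      (hmem (k := fun q : (((ℕ × ℕ) × ℕ) × ℕ) × ℕ => q.1.1.1) (r := fun q => q.1.2)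
        (x := fun q => q.2) (Computable.fst.comp (Computable.fst.comp Computable.fst))
        (Computable.snd.comp Computable.fst) Computable.snd)).of_eq fun q =>
      congrArg Finset.card (Finset.ext fun x => ?_)
    simp only [Finset.mem_filter, Finset.mem_range, and_iff_right_iff_imp]
    exact lt_of_mem_unrefutedBelow
  refine (ComputablePred.exists_lt
    (p := fun (q : (ℕ × ℕ) × ℕ) r => (unrefutedBelow q.1.1 q.1.2 r).card ≤ m q.1.1 ∧
      q.2 ∈ unrefutedBelow q.1.1 q.1.2 r)
    (Computable.succ.comp (Computable.snd.comp Computable.fst))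
    (ComputablePred.and
      (ComputablePred.le_of_computable hcard
        (hm.comp (Computable.fst.comp (Computable.fst.comp Computable.fst))))
      (hmem (k := fun q : ((ℕ × ℕ) × ℕ) × ℕ => q.1.1) (r := fun q => q.2)
        (x := fun q => q.1.2) (Computable.fst.comp Computable.fst) Computable.snd
        (Computable.snd.comp Computable.fst)))).of_eq fun q => mem_sigmaTwoApprox.symm

lemma exists_code_eval_pair {R : ℕ → ℕ → ℕ → Bool}
    (hR : Computable fun p : ℕ × ℕ × ℕ => R p.1 p.2.1 p.2.2) :
    ∃ code : Nat.Partrec.Code, ∀ q b, code.eval (Nat.pair q b) =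
      Part.some (Encodable.encode (R q.unpair.1 q.unpair.2 b)) := by
  have hl : Computable fun n : ℕ => n.unpair.1.unpair :=
    Computable.unpair.comp (Computable.fst.comp Computable.unpair)
  have harg : Computable fun n : ℕ => (n.unpair.1.unpair.1, n.unpair.1.unpair.2, n.unpair.2) :=
    (Computable.fst.comp hl).pair
      ((Computable.snd.comp hl).pair (Computable.snd.comp Computable.unpair))
  have hF : Computable fun n : ℕ =>
      Encodable.encode (R n.unpair.1.unpair.1 n.unpair.1.unpair.2 n.unpair.2) :=
    Computable.comp (f := fun p : ℕ × ℕ × ℕ => Encodable.encode (R p.1 p.2.1 p.2.2))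
      (g := fun n : ℕ => (n.unpair.1.unpair.1, n.unpair.1.unpair.2, n.unpair.2))
      (Computable.encode.comp hR) harg
  obtain ⟨code, hcode⟩ := Nat.Partrec.Code.exists_code.1 (Partrec.nat_iff.1 hF.partrec)
  exact ⟨code, fun q b => by simp [hcode]⟩

/-- The approximations to an infinite `Σ⁰₂` set settle on a subset of the desired size. -/
lemma exists_sigmaTwoApprox_subset {R : ℕ → ℕ → ℕ → Bool}
    (hR : Computable fun p : ℕ × ℕ × ℕ => R p.1 p.2.1 p.2.2)
    (hinf : {n : ℕ | ∃ a : ℕ, ∀ b : ℕ, R n a b = true}.Infinite) :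
    ∃ e, ∀ m, ∃ u₀, ∀ u ≥ u₀, (sigmaTwoApprox m e u).card = m ∧
      ∀ x ∈ sigmaTwoApprox m e u, ∃ a, ∀ b, R x a b = true := by
  classical
  obtain ⟨code, heval⟩ := exists_code_eval_pair hR
  let Holds : ℕ → Prop := fun q => ∀ b, R q.unpair.1 q.unpair.2 b = true
  have hpos : ∀ q, Holds q → ∀ u, IsUnrefuted (Encodable.encode code) u q := by
    intro q hq u b _ h
    rw [Denumerable.ofNat_encode] at h
    have := Nat.Partrec.Code.evaln_sound (Option.mem_def.2 h)
    rw [heval, hq b] at this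
    simp at this
  have hneg : ∀ q, ¬ Holds q → ∃ u₀, ∀ u ≥ u₀, ¬ IsUnrefuted (Encodable.encode code) u q := by
    intro q hq
    obtain ⟨b, hb⟩ := not_forall.1 hq
    have h0 : 0 ∈ code.eval (Nat.pair q b) := by
      rw [heval, Bool.eq_false_of_not_eq_true hb]
      simp
    obtain ⟨k, hk⟩ := Nat.Partrec.Code.evaln_complete.1 h0
    refine ⟨max k (b + 1), fun u hu h => h b (by lia) ?_⟩
    rw [Denumerable.ofNat_encode]
    exact Nat.Partrec.Code.evaln_mono (by lia) hk
  have hstage : ∀ r, ∃ u₀, ∀ u ≥ u₀, ∀ q < r,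
      IsUnrefuted (Encodable.encode code) u q → Holds q := by
    intro r
    induction r with
    | zero => exact ⟨0, fun _ _ _ h => absurd h (Nat.not_lt_zero _)⟩
    | succ r ih =>
      obtain ⟨u₁, h₁⟩ := ih
      by_cases hr : Holds r
      · refine ⟨u₁, fun u hu q hq h => ?_⟩
        rcases Nat.lt_succ_iff_lt_or_eq.1 hq with h' | rfl
        · exact h₁ u hu q h' h
        · exact hr
      · obtain ⟨u₂, h₂⟩ := hneg r hr
        refine ⟨max u₁ u₂, fun u hu q hq h => ?_⟩
        rcases Nat.lt_succ_iff_lt_or_eq.1 hq with h' | rfl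
        · exact h₁ u (by lia) q h' h
        · exact absurd h (h₂ u (by lia))
  let T : ℕ → Finset ℕ := fun r => ((Finset.range r).filter Holds).image fun q => q.unpair.1
  have hTstep : ∀ r, (T (r + 1)).card ≤ (T r).card + 1 := by
    intro r
    have : T (r + 1) ⊆ insert r.unpair.1 (T r) := by
      intro x hx
      obtain ⟨q, hq, rfl⟩ := Finset.mem_image.1 hx
      obtain ⟨hq, hh⟩ := Finset.mem_filter.1 hq
      rcases Nat.lt_succ_iff_lt_or_eq.1 (Finset.mem_range.1 hq) with h | rfl
      · exact Finset.mem_insert_of_mem (Finset.mem_image_of_mem _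
          (Finset.mem_filter.2 ⟨Finset.mem_range.2 h, hh⟩))
      · exact Finset.mem_insert_self _ _
    exact (Finset.card_le_card this).trans (Finset.card_insert_le _ _)
  have hTunbounded : ∀ m, ∃ r, m ≤ (T r).card := by
    intro m
    obtain ⟨t, ht, rfl⟩ := hinf.exists_subset_card_eq m
    choose! a ha using fun x (hx : x ∈ t) => (ht hx : ∃ a, ∀ b, R x a b = true)
    refine ⟨t.sup (fun x => Nat.pair x (a x)) + 1, Finset.card_le_card fun x hx => ?_⟩
    refine Finset.mem_image.2 ⟨Nat.pair x (a x), Finset.mem_filter.2 ⟨Finset.mem_range.2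
      (Nat.lt_succ_of_le (Finset.le_sup (f := fun x => Nat.pair x (a x)) hx)), ?_⟩, by simp⟩
    simpa [Holds] using ha x hx
  refine ⟨Encodable.encode code, fun m => ?_⟩
  obtain ⟨r, hr⟩ : ∃ r, (T r).card = m := by
    have hex := hTunbounded m
    refine ⟨Nat.find hex, le_antisymm ?_ (Nat.find_spec hex)⟩
    rcases h : Nat.find hex with _ | i
    · simp [T]
    · have := Nat.find_min hex (m := i) (by lia)
      have := hTstep i
      lia
  obtain ⟨u₀, hu₀⟩ := hstage r
  refine ⟨max u₀ r, fun u hu => ?_⟩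
  have hTu : unrefutedBelow (Encodable.encode code) u r = T r := by
    ext x
    simp only [mem_unrefutedBelow, T, Finset.mem_image, Finset.mem_filter, Finset.mem_range,
      and_assoc]
    exact exists_congr fun q => and_congr_right fun hq => and_congr_left fun _ =>
      ⟨hu₀ u (by lia) q hq, fun h => hpos q h u⟩
  have hsub : T r ⊆ sigmaTwoApprox m (Encodable.encode code) u := fun x hx =>
    mem_sigmaTwoApprox.2 ⟨r, by lia, by rw [hTu, hr], by rwa [hTu]⟩
  have heq : T r = sigmaTwoApprox m (Encodable.encode code) u :=
    Finset.eq_of_subset_of_card_le hsub (by rw [hr]; exact card_sigmaTwoApprox_le _ _ _)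
  rw [← heq]
  refine ⟨hr, fun x hx => ?_⟩
  obtain ⟨q, hq, rfl⟩ := Finset.mem_image.1 hx
  exact ⟨q.unpair.2, (Finset.mem_filter.1 hq).2⟩

lemma computable_splitSize (K : ℕ) : Computable fun e : ℕ => 3 * K * (11 * (e + K + 5)) := by
  have hadd : Computable fun e : ℕ => e + K + 5 :=
    (Primrec.nat_add.comp (Primrec.nat_add.comp Primrec.id (Primrec.const K))
      (Primrec.const 5)).to_comp
  have hmul : Computable fun e : ℕ => 11 * (e + K + 5) :=
    Primrec.nat_mul.to_comp.comp (Computable.const 11) hadd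
  exact Primrec.nat_mul.to_comp.comp (Computable.const (3 * K)) hmul

/-- For any symmetric addition-like `f`, there is a computable instance of `RT^f_2`
with no `Σ⁰₂` solution. -/
theorem stmt_4 (f : ℕ → ℕ → ℕ) (hsym : ∀ x y, f x y = f y x) (hf : AdditionLike f) :
    ∃ c : ℕ → Bool, Computable c ∧
      ∀ R : ℕ → ℕ → ℕ → Bool,
        Computable (fun p : ℕ × ℕ × ℕ => R p.1 p.2.1 p.2.2) →
        {n : ℕ | ∃ a : ℕ, ∀ b : ℕ, R n a b = true}.Infinite →
          ∃ x y x' y' : ℕ,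
            (∃ a, ∀ b, R x a b = true) ∧ (∃ a, ∀ b, R y a b = true) ∧
            (∃ a, ∀ b, R x' a b = true) ∧ (∃ a, ∀ b, R y' a b = true) ∧
            x ≠ y ∧ x' ≠ y' ∧ c (f x y) ≠ c (f x' y') := by
  obtain ⟨hfc, ⟨g, hg, hfg⟩, b, hb⟩ := hf
  obtain ⟨p, B, hpc, hBc, hB, hBle, hBf⟩ := exists_blocks hfc hg hfg
  obtain ⟨m, hm, hmdef⟩ : ∃ m : ℕ → ℕ, Computable m ∧
      ∀ e, m e = 3 * (b + 1) * (11 * (e + (b + 1) + 5)) :=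
    ⟨_, computable_splitSize (b + 1), fun _ => rfl⟩
  obtain ⟨c, hc, hsplit⟩ := exists_computable_coloring (G := fun e u => sigmaTwoApprox (m e) e u)
    hsym hfc (fun x y hxy S hS => (hb x y hxy S hS).trans b.le_succ) b.succ_pos hpc hBc hB hBle hBf
    (fun _ _ _ => lt_of_mem_sigmaTwoApprox)
    (fun e u => (card_sigmaTwoApprox_le (m e) e u).trans_eq (hmdef e))
    (computable_sigmaTwoApprox hm)
  refine ⟨c, hc, fun R hR hinf => ?_⟩
  obtain ⟨e, he⟩ := exists_sigmaTwoApprox_subset hR hinf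
  obtain ⟨u₀, hu₀⟩ := he (m e)
  obtain ⟨s, hs, hsp⟩ := hinf.exists_gt (p u₀)
  have hBs : u₀ ≤ B s := not_lt.1 fun h => absurd ((hB s u₀).1 h) (by lia)
  obtain ⟨hcard, hmem⟩ := hu₀ (B s) hBs
  obtain ⟨x, hx, x', hx', hne⟩ := hsplit e s (hcard.trans (hmdef e)).ge
  have hlt : ∀ z ∈ sigmaTwoApprox (m e) e (B s), z ≠ s :=
    fun z hz => ((lt_of_mem_sigmaTwoApprox hz).trans_le (hBle s)).ne
  exact ⟨x, s, x', s, hmem x hx, hs, hmem x' hx', hs, hlt x hx, hlt x' hx', hne⟩
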